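/- Let f = (1/2)·1_{[−1,1]} be the uniform density on [−1,1], and let π, τ be permutations of {1,…,n+1}. If I_π ⊆ I_τ, then P(f,π) ≥ P(f,τ). -/

import Mathlib

open MeasureTheory

noncomputable section

/-- Walk positions: `walk n x i = x 0 + ⋯ + x (i-1)` (so `walk n x 0 = 0`). -/
def walk (n : ℕ) (x : Fin n → ℝ) (i : Fin (n + 1)) : ℝ :=
  ∑ j : Fin n, if (j : ℕ) < (i : ℕ) then x j else 0

/-- The region of step tuples generating the ordinal pattern `π`. -/
def D (n : ℕ) (π : Equiv.Perm (Fin (n + 1))) : Set (Fin n → ℝ) :=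
  {x | (∀ i j : Fin (n + 1), i ≠ j → walk n x i ≠ walk n x j) ∧
       (∀ i j : Fin (n + 1), walk n x i < walk n x j ↔ π i < π j)}

/-- The matrix `L_π`. -/
def L (n : ℕ) (π : Equiv.Perm (Fin (n + 1))) : Matrix (Fin n) (Fin n) ℝ :=
  fun i j =>
    if (π i.castSucc : ℕ) ≤ (j : ℕ) ∧ (j : ℕ) < (π i.succ : ℕ) then 1
    else if (π i.succ : ℕ) ≤ (j : ℕ) ∧ (j : ℕ) < (π i.castSucc : ℕ) then -1
    else 0

/-- Partial sum `x i + x (i+1) + ⋯ + x (j-1)`. -/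
def psum (n : ℕ) (x : Fin n → ℝ) (i j : Fin (n + 1)) : ℝ :=
  ∑ k : Fin n, if (i : ℕ) ≤ (k : ℕ) ∧ (k : ℕ) < (j : ℕ) then x k else 0

/-- The level count `lev(π)_j`. -/
def lev (n : ℕ) (π : Equiv.Perm (Fin (n + 1))) (j : Fin n) : ℕ :=
  (Finset.univ.filter fun i : Fin n =>
    ((π i.castSucc : ℕ) ≤ (j : ℕ) ∧ (j : ℕ) < (π i.succ : ℕ)) ∨
    ((π i.succ : ℕ) ≤ (j : ℕ) ∧ (j : ℕ) < (π i.castSucc : ℕ))).card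

/-- The polytope of steps `P_π`. -/
def Ppoly (n : ℕ) (π : Equiv.Perm (Fin (n + 1))) : Set (Fin n → ℝ) :=
  {x | (∀ i, 0 ≤ x i) ∧ ∀ i : Fin n,
    psum n x (min (π i.castSucc) (π i.succ)) (max (π i.castSucc) (π i.succ)) ≤ 1}

/-- The set of positive roots, identified with pairs `i < j`. -/
def PosRoot (n : ℕ) := {p : Fin (n + 1) × Fin (n + 1) // p.1 < p.2}

/-- The Shi condition for an alcove address. -/
def Shi (n : ℕ) (k : PosRoot n → ℤ) : Prop :=
  ∀ (i t j : Fin (n + 1)) (hit : i < t) (htj : t < j),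
    k ⟨(i, t), hit⟩ + k ⟨(t, j), htj⟩ ≤ k ⟨(i, j), hit.trans htj⟩ ∧
    k ⟨(i, j), hit.trans htj⟩ ≤ k ⟨(i, t), hit⟩ + k ⟨(t, j), htj⟩ + 1

/-- The alcove with address `k`, in step coordinates. -/
def alcove (n : ℕ) (k : PosRoot n → ℤ) : Set (Fin n → ℝ) :=
  {x | ∀ p : PosRoot n,
    (k p : ℝ) < psum n x p.1.1 p.1.2 ∧ psum n x p.1.1 p.1.2 < (k p : ℝ) + 1}

/-- The root ideal `I_π`. -/
def rootIdeal (n : ℕ) (π : Equiv.Perm (Fin (n + 1))) : Set (PosRoot n) :=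
  {p | ∃ c : Fin n,
    min (π c.castSucc : ℕ) (π c.succ : ℕ) ≤ (p.1.1 : ℕ) ∧
    (p.1.2 : ℕ) ≤ max (π c.castSucc : ℕ) (π c.succ : ℕ)}

/-- The level count matrix `lev(π)_{i,j}`. -/
def lev2 (n : ℕ) (π : Equiv.Perm (Fin (n + 1))) (i j : Fin n) : ℕ :=
  (Finset.univ.filter fun k : Fin n =>
    ((π k.castSucc : ℕ) ≤ (i : ℕ) ∧ (π k.castSucc : ℕ) ≤ (j : ℕ) ∧
     (i : ℕ) < (π k.succ : ℕ) ∧ (j : ℕ) < (π k.succ : ℕ)) ∨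
    ((π k.succ : ℕ) ≤ (i : ℕ) ∧ (π k.succ : ℕ) ≤ (j : ℕ) ∧
     (i : ℕ) < (π k.castSucc : ℕ) ∧ (j : ℕ) < (π k.castSucc : ℕ))).card

theorem walk_zero (n : ℕ) (x : Fin n → ℝ) : walk n x 0 = 0 := by
  simp [walk]

theorem walk_succ (n : ℕ) (x : Fin n → ℝ) (i : Fin n) :
    walk n x i.succ = walk n x i.castSucc + x i := by
  have h : x i = ∑ j : Fin n, if j = i then x j else 0 := by simp
  rw [h]
  unfold walk
  rw [← Finset.sum_add_distrib]
  refine Finset.sum_congr rfl fun j _ => ?_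
  simp only [Fin.val_succ, Fin.val_castSucc, Fin.ext_iff]
  split_ifs <;> first | omega | simp

/-- The linear map sending `x` to the increments of its walk read in the order `σ`. -/
def stepPerm (n : ℕ) (σ : Equiv.Perm (Fin (n + 1))) : (Fin n → ℝ) →ₗ[ℝ] (Fin n → ℝ) where
  toFun x i := walk n x (σ i.succ) - walk n x (σ i.castSucc)
  map_add' x y := by
    ext i
    have h (k : Fin (n + 1)) : walk n (x + y) k = walk n x k + walk n y k := by
      simp only [walk, Pi.add_apply, ← Finset.sum_add_distrib]
      exact Finset.sum_congr rfl fun j _ => by split_ifs <;> simp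
    simp only [h, Pi.add_apply]
    ring
  map_smul' c x := by
    ext i
    have h (k : Fin (n + 1)) : walk n (c • x) k = c * walk n x k := by
      simp [walk, Finset.mul_sum]
    simp only [h, Pi.smul_apply, smul_eq_mul, RingHom.id_apply]
    ring

theorem stepPerm_apply (n : ℕ) (σ : Equiv.Perm (Fin (n + 1))) (x : Fin n → ℝ) (i : Fin n) :
    stepPerm n σ x i = walk n x (σ i.succ) - walk n x (σ i.castSucc) := rfl

theorem walk_stepPerm (n : ℕ) (σ : Equiv.Perm (Fin (n + 1))) (x : Fin n → ℝ)
    (i : Fin (n + 1)) : walk n (stepPerm n σ x) i = walk n x (σ i) - walk n x (σ 0) := by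
  induction i using Fin.induction with
  | zero => simp [walk_zero]
  | succ i ih =>
    rw [walk_succ, ih, stepPerm_apply]
    ring

theorem stepPerm_one (n : ℕ) : stepPerm n 1 = 1 := by
  ext1 x
  ext i
  simp [stepPerm_apply, walk_succ]

theorem stepPerm_mul (n : ℕ) (σ τ : Equiv.Perm (Fin (n + 1))) :
    stepPerm n (σ * τ) = stepPerm n τ * stepPerm n σ := by
  refine LinearMap.ext fun x => funext fun i => ?_
  rw [Module.End.mul_apply, stepPerm_apply, stepPerm_apply, walk_stepPerm, walk_stepPerm]
  simp

theorem stepPerm_pow (n : ℕ) (σ : Equiv.Perm (Fin (n + 1))) (k : ℕ) :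
    stepPerm n (σ ^ k) = stepPerm n σ ^ k := by
  induction k with
  | zero => simp [stepPerm_one]
  | succ k ih => rw [pow_succ, stepPerm_mul, ih, pow_succ']

theorem abs_det_stepPerm (n : ℕ) (σ : Equiv.Perm (Fin (n + 1))) :
    |LinearMap.det (stepPerm n σ)| = 1 := by
  have h : LinearMap.det (stepPerm n σ) ^ orderOf σ = 1 := by
    rw [← map_pow, ← stepPerm_pow, pow_orderOf_eq_one, stepPerm_one, map_one]
  refine (pow_eq_one_iff_of_nonneg (abs_nonneg _) (orderOf_pos σ).ne').1 ?_
  rw [← abs_pow, h, abs_one]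

theorem volume_preimage_stepPerm (n : ℕ) (σ : Equiv.Perm (Fin (n + 1)))
    (s : Set (Fin n → ℝ)) : volume (stepPerm n σ ⁻¹' s) = volume s := by
  have h := abs_det_stepPerm n σ
  have h0 : LinearMap.det (stepPerm n σ) ≠ 0 := by
    intro h0
    simp [h0] at h
  rw [Measure.addHaar_preimage_linearMap _ h0, abs_inv, h]
  simp

theorem mem_D_iff (n : ℕ) (π : Equiv.Perm (Fin (n + 1))) (x : Fin n → ℝ) :
    x ∈ D n π ↔ ∀ i, 0 < stepPerm n π⁻¹ x i := by
  have key : StrictMono (walk n x ∘ (π⁻¹ : Equiv.Perm (Fin (n + 1)))) ↔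
      ∀ i, 0 < stepPerm n π⁻¹ x i := by
    rw [Fin.strictMono_iff_lt_succ]
    simp [stepPerm_apply]
  rw [← key]
  constructor
  · rintro ⟨-, h⟩ a b hab
    simpa [h] using hab
  · intro h
    have h' (i j : Fin (n + 1)) : walk n x i < walk n x j ↔ π i < π j := by
      simpa using h.lt_iff_lt (a := π i) (b := π j)
    refine ⟨fun i j hij heq => hij ?_, h'⟩
    exact π.injective (h.injective (by simpa using heq))

/-- Positive gap vectors whose walk, read in the order `π`, has steps in `[-1, 1]`. -/
def gapRegion (n : ℕ) (π : Equiv.Perm (Fin (n + 1))) : Set (Fin n → ℝ) :=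
  {u | (∀ i, 0 < u i) ∧ stepPerm n π u ∈ Set.Icc (-1) 1}

theorem D_inter_Icc (n : ℕ) (π : Equiv.Perm (Fin (n + 1))) :
    D n π ∩ Set.Icc (-1) 1 = stepPerm n π⁻¹ ⁻¹' gapRegion n π := by
  ext x
  have h : stepPerm n π (stepPerm n π⁻¹ x) = x := by
    rw [← Module.End.mul_apply, ← stepPerm_mul, inv_mul_cancel, stepPerm_one,
      Module.End.one_apply]
  rw [Set.mem_inter_iff, mem_D_iff, Set.mem_preimage]
  simp only [gapRegion, Set.mem_ofPred_eq, h]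

theorem volume_D_inter_Icc (n : ℕ) (π : Equiv.Perm (Fin (n + 1))) :
    volume (D n π ∩ Set.Icc (-1) 1) = volume (gapRegion n π) := by
  rw [D_inter_Icc, volume_preimage_stepPerm]

theorem strictMono_walk (n : ℕ) (u : Fin n → ℝ) (hu : ∀ i, 0 < u i) :
    StrictMono (walk n u) := by
  rw [Fin.strictMono_iff_lt_succ]
  intro i
  rw [walk_succ]
  linarith [hu i]

theorem abs_sub_eq_max_sub_min {α : Type*} [LinearOrder α] {g : α → ℝ} (hg : Monotone g)
    (a b : α) : |g a - g b| = g (max a b) - g (min a b) := by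
  rw [hg.map_max, hg.map_min, max_sub_min_eq_abs']

theorem gapRegion_subset (n : ℕ) (π τ : Equiv.Perm (Fin (n + 1)))
    (hsub : rootIdeal n π ⊆ rootIdeal n τ) : gapRegion n τ ⊆ gapRegion n π := by
  rintro u ⟨hu, hτ⟩
  have hg := (strictMono_walk n u hu).monotone
  have hτ' (c : Fin n) : |stepPerm n τ u c| ≤ 1 := abs_le.2 ⟨hτ.1 c, hτ.2 c⟩
  suffices h : ∀ c, |stepPerm n π u c| ≤ 1 from
    ⟨hu, fun c => (abs_le.1 (h c)).1, fun c => (abs_le.1 (h c)).2⟩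
  intro c
  have hne : π c.castSucc ≠ π c.succ := π.injective.ne (Fin.castSucc_lt_succ).ne
  have hmem : (⟨(min (π c.castSucc) (π c.succ), max (π c.castSucc) (π c.succ)),
      min_lt_max.2 hne⟩ : PosRoot n) ∈ rootIdeal n π :=
    ⟨c, by simp [Fin.coe_min], by simp [Fin.coe_max]⟩
  obtain ⟨d, hd₁, hd₂⟩ := hsub hmem
  have h₁ : min (τ d.castSucc) (τ d.succ) ≤ min (π c.castSucc) (π c.succ) := by
    rwa [Fin.le_def, Fin.coe_min]
  have h₂ : max (π c.castSucc) (π c.succ) ≤ max (τ d.castSucc) (τ d.succ) := by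
    rwa [Fin.le_def, Fin.coe_max (τ d.castSucc)]
  have h := hτ' d
  rw [stepPerm_apply, abs_sub_eq_max_sub_min hg, max_comm, min_comm] at h
  rw [stepPerm_apply, abs_sub_eq_max_sub_min hg, max_comm, min_comm]
  linarith [hg h₁, hg h₂]

theorem setIntegral_prod_uniform (n : ℕ) (s : Set (Fin n → ℝ)) :
    ∫ x in s, ∏ i : Fin n, (if -1 ≤ x i ∧ x i ≤ 1 then (1 : ℝ) / 2 else 0) =
      volume.real (s ∩ Set.Icc (-1) 1) * (1 / 2) ^ n := by
  have h : (fun x : Fin n → ℝ =>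
      ∏ i : Fin n, (if -1 ≤ x i ∧ x i ≤ 1 then (1 : ℝ) / 2 else 0)) =
      (Set.Icc (-1) 1).indicator fun _ => (1 / 2) ^ n := by
    ext x
    by_cases hx : x ∈ Set.Icc (-1) 1
    · rw [Set.indicator_of_mem hx,
        Finset.prod_congr rfl fun i _ => if_pos ⟨hx.1 i, hx.2 i⟩]
      simp
    · rw [Set.indicator_of_notMem hx]
      have : ∃ i, ¬(-1 ≤ x i ∧ x i ≤ 1) := by
        by_contra! hc
        exact hx ⟨fun i => (hc i).1, fun i => (hc i).2⟩
      obtain ⟨i, hi⟩ := this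
      exact Finset.prod_eq_zero (Finset.mem_univ i) (if_neg hi)
  rw [h, setIntegral_indicator measurableSet_Icc, setIntegral_const, smul_eq_mul]

/-- for the uniform density on `[-1,1]`, `I_π ⊆ I_τ` implies
`P(f,π) ≥ P(f,τ)`. -/
theorem stmt_16 (n : ℕ) (hn : 1 ≤ n) (π τ : Equiv.Perm (Fin (n + 1)))
    (hsub : rootIdeal n π ⊆ rootIdeal n τ) :
    ∫ x in D n τ, ∏ i : Fin n, (if -1 ≤ x i ∧ x i ≤ 1 then (1 : ℝ) / 2 else 0) ≤
    ∫ x in D n π, ∏ i : Fin n, (if -1 ≤ x i ∧ x i ≤ 1 then (1 : ℝ) / 2 else 0) := by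
  rw [setIntegral_prod_uniform, setIntegral_prod_uniform]
  refine mul_le_mul_of_nonneg_right ?_ (by positivity)
  refine ENNReal.toReal_mono ?_ ?_
  · exact ((measure_mono Set.inter_subset_right).trans_lt isCompact_Icc.measure_lt_top).ne
  · rw [volume_D_inter_Icc, volume_D_inter_Icc]
    exact measure_mono (gapRegion_subset n π τ hsub)
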